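/- arXiv:1505.07553 — 5 statements merged into one kernel-verified Lean document; each statement's English description precedes it below -/
import Mathlib

section
/- Let p be a prime, n ≥ 2, and F a finite field with p^n elements. Let ℓ be a positive divisor of Φ_n(p), where Φ_n is the n-th cyclotomic polynomial. Let m be a positive divisor of n with m < n, and let u ∈ F satisfy u^(p^m) = u and u ≠ 0 (i.e., u lies in the proper subfield of F with p^m elements). Let g be a generator of the multiplicative group F^*, let s ∈ F^*, and let k, k' be natural numbers with g^k = s and g^{k'} = u·s. Then k ≡ k' (mod ℓ). -/
/-- Multiplying the target `s` by a nonzero element `u` of a proper subfield of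
`F = 𝔽_{p^n}` does not change its discrete logarithm modulo `ℓ`, for any positive
divisor `ℓ` of `Φ_n(p)`. -/
theorem stmt0 (p : ℕ) (hp : p.Prime) (n : ℕ) (hn : 2 ≤ n)
    (F : Type*) [Field F] [Fintype F] (hF : Fintype.card F = p ^ n)
    (ℓ : ℕ) (hℓpos : 0 < ℓ)
    (hℓdvd : (ℓ : ℤ) ∣ (Polynomial.cyclotomic n ℤ).eval (p : ℤ))
    (m : ℕ) (hm : 0 < m) (hmdvd : m ∣ n) (hmlt : m < n)
    (u : F) (hu : u ^ (p ^ m) = u) (hu0 : u ≠ 0)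
    (g : Fˣ) (hg : ∀ y : Fˣ, y ∈ Subgroup.zpowers g)
    (s : F) (hs : s ≠ 0) (k k' : ℕ)
    (hk : (g : F) ^ k = s) (hk' : (g : F) ^ k' = u * s) :
    k ≡ k' [MOD ℓ] := by
  have hord : (orderOf g : ℤ) = (p : ℤ) ^ n - 1 := by
    classical
    rw [orderOf_eq_card_of_forall_mem_zpowers hg, Nat.card_eq_fintype_card, Fintype.card_units, hF,
      Nat.cast_sub (Nat.one_le_pow _ _ hp.pos)]
    push_cast
    rfl
  have hpoly : ((p : ℤ) ^ m - 1) * (Polynomial.cyclotomic n ℤ).eval (p : ℤ) ∣ (p : ℤ) ^ n - 1 := by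
    have h := Polynomial.X_pow_sub_one_mul_cyclotomic_dvd_X_pow_sub_one_of_dvd ℤ
      (Nat.mem_properDivisors.2 ⟨hmdvd, hmlt⟩)
    have h2 := Polynomial.eval_dvd (x := (p : ℤ)) h
    simpa using h2
  have hne : (p : ℤ) ^ m - 1 ≠ 0 := by
    have : 1 < p ^ m := Nat.one_lt_pow hm.ne' hp.one_lt
    have : (1 : ℤ) < (p : ℤ) ^ m := by exact_mod_cast this
    omega
  let v : Fˣ := Units.mk0 u hu0
  have hv : v ^ (p ^ m) = v := Units.ext (by simpa [v] using hu)
  have hgv : g ^ k' = v * g ^ k := Units.ext (by simp [v, hk, hk'])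
  have hz : g ^ ((k' : ℤ) - k) = v := by
    rw [zpow_sub, zpow_natCast, zpow_natCast, hgv, mul_inv_cancel_right]
  have h1 : g ^ (((k' : ℤ) - k) * ((p : ℤ) ^ m - 1)) = 1 := by
    rw [zpow_mul, hz, zpow_sub, zpow_one, ← Nat.cast_pow, zpow_natCast, hv, mul_inv_cancel]
  have h2 := orderOf_dvd_iff_zpow_eq_one.2 h1
  rw [hord] at h2
  have h3 := hpoly.trans h2
  rw [mul_comm ((k' : ℤ) - k)] at h3
  exact Nat.modEq_iff_dvd.2 (hℓdvd.trans ((mul_dvd_mul_iff_left hne).1 h3))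
end

section
/- Let p be a prime, n ≥ 2, and F a finite field with p^n elements. Let m be a positive divisor of n with m < n, and let u ∈ F be nonzero with u^(p^m) = u. Let ℓ be a positive divisor of Φ_n(p), where Φ_n is the n-th cyclotomic polynomial. Then u^((p^n − 1)/ℓ) = 1. -/
/-- If `u` is a nonzero element of the subfield with `p^m` elements of the finite
field `F` with `p^n` elements (`m` a positive proper divisor of `n`), and `ℓ` is a
positive divisor of `Φ_n(p)`, then `u^((p^n - 1)/ℓ) = 1`. -/
theorem stmt2 (p : ℕ) (hp : p.Prime) (n : ℕ) (hn : 2 ≤ n)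
    (F : Type*) [Field F] [Fintype F] (hF : Fintype.card F = p ^ n)
    (m : ℕ) (hm : 0 < m) (hmdvd : m ∣ n) (hmlt : m < n)
    (u : F) (hu : u ^ (p ^ m) = u) (hu0 : u ≠ 0)
    (ℓ : ℕ) (hℓpos : 0 < ℓ)
    (hℓdvd : (ℓ : ℤ) ∣ (Polynomial.cyclotomic n ℤ).eval (p : ℤ)) :
    u ^ ((p ^ n - 1) / ℓ) = 1 := by
  have h1 := Polynomial.X_pow_sub_one_mul_cyclotomic_dvd_X_pow_sub_one_of_dvd ℤ
    (Nat.mem_properDivisors.mpr ⟨hmdvd, hmlt⟩)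
  have h2 := Polynomial.eval_dvd (x := (p : ℤ)) h1
  simp only [Polynomial.eval_mul, Polynomial.eval_sub, Polynomial.eval_pow, Polynomial.eval_X,
    Polynomial.eval_one] at h2
  have h3 : ((p : ℤ) ^ m - 1) * ℓ ∣ (p : ℤ) ^ n - 1 := (mul_dvd_mul_left _ hℓdvd).trans h2
  have hpm : 1 ≤ p ^ m := Nat.one_le_pow _ _ hp.pos
  have hpn : 1 ≤ p ^ n := Nat.one_le_pow _ _ hp.pos
  have h4 : (p ^ m - 1) * ℓ ∣ p ^ n - 1 := by
    zify [hpm, hpn]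
    exact h3
  have h5 : u ^ (p ^ m - 1) = 1 := by
    apply mul_right_cancel₀ hu0
    rw [← pow_succ, Nat.sub_add_cancel hpm, hu, one_mul]
  obtain ⟨k, hk⟩ := h4
  have h6 : (p ^ n - 1) / ℓ = (p ^ m - 1) * k := by
    rw [hk, mul_right_comm]
    exact Nat.mul_div_cancel _ hℓpos
  rw [h6, pow_mul, h5, one_pow]
end

section
/- Let p be a prime and n an even integer with n ≥ 2. Let P_y = Y² + y₁Y + y₀ be a monic irreducible quadratic polynomial over 𝔽_p, let P_z ∈ 𝔽_p[X] be monic of degree n/2, and suppose the composition ψ(X) = P_z(X)² + y₁·P_z(X) + y₀ is irreducible over 𝔽_p (so it has degree n). Let K = 𝔽_p[X]/(ψ(X)) and let x denote the image of X in K. Then for every s ∈ K there exist u ∈ K with u ≠ 0 lying in the 𝔽_p-span of {1, P_z(x)} (equivalently, u^(p²) = u), and a polynomial r ∈ 𝔽_p[X] with deg r ≤ n − 2, such that s = u · r(x). -/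
open Polynomial

theorem aux_ne (p : ℕ) [Fact p.Prime] (k : ℕ) (Pz ψ : (ZMod p)[X]) (hm : Pz.Monic)
    (hd : Pz.natDegree = k + 1) (hψ : ψ.natDegree = 2 * (k + 1)) (c d : ZMod p)
    (h : c ≠ 0 ∨ d ≠ 0) : AdjoinRoot.mk ψ (C c + C d * Pz) ≠ 0 := by
  intro h0
  rw [AdjoinRoot.mk_eq_zero] at h0
  have hle : (C c + C d * Pz).natDegree ≤ k + 1 := by
    refine (natDegree_add_le _ _).trans (max_le (by simp) ?_)
    exact (natDegree_C_mul_le _ _).trans hd.le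
  have hz : C c + C d * Pz = 0 := by
    by_contra hne
    have := natDegree_le_of_dvd h0 hne
    omega
  have hdz : d = 0 := by
    have := congrArg (fun q => coeff q (k + 1)) hz
    have h1 : Pz.coeff (k + 1) = 1 := by rw [← hd]; exact hm
    simpa [coeff_C, h1] using this
  subst hdz
  simp at hz
  simp [hz] at h

theorem stmt3 (p : ℕ) [Fact p.Prime] (n : ℕ) (hn : 2 ≤ n) (hneven : Even n)
    (y₀ y₁ : ZMod p)
    (hPy : Irreducible (X ^ 2 + C y₁ * X + C y₀ : (ZMod p)[X]))
    (Pz : (ZMod p)[X]) (hPzmonic : Pz.Monic) (hPzdeg : Pz.natDegree = n / 2)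
    (ψ : (ZMod p)[X]) (hψdef : ψ = Pz ^ 2 + C y₁ * Pz + C y₀)
    (hψirr : Irreducible ψ)
    (s : AdjoinRoot ψ) :
    ∃ u : AdjoinRoot ψ, u ≠ 0 ∧
      (∃ a b : ZMod p, u = AdjoinRoot.mk ψ (C a + C b * Pz)) ∧
      ∃ r : (ZMod p)[X], r.natDegree ≤ n - 2 ∧ s = u * AdjoinRoot.mk ψ r := by
  obtain ⟨k, rfl⟩ : ∃ k, n = 2 * (k + 1) := by
    obtain ⟨j, rfl⟩ := hneven
    exact ⟨j - 1, by omega⟩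
  have hd : Pz.natDegree = k + 1 := by omega
  have hlow : (C y₁ * Pz + C y₀).degree < (Pz ^ 2).degree := by
    rw [degree_eq_natDegree (hPzmonic.pow 2).ne_zero, hPzmonic.natDegree_pow, hd]
    refine lt_of_le_of_lt (degree_le_of_natDegree_le (n := k + 1) ?_) (by exact_mod_cast (by omega))
    refine (natDegree_add_le _ _).trans (max_le ?_ (by simp))
    exact (natDegree_C_mul_le _ _).trans hd.le
  have hψm : ψ.Monic := by
    rw [hψdef, add_assoc]; exact (hPzmonic.pow 2).add_of_left hlow
  have hψd : ψ.natDegree = 2 * (k + 1) := by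
    rw [hψdef, add_assoc, natDegree_add_eq_left_of_degree_lt hlow, hPzmonic.natDegree_pow, hd]
  have : Fact (Irreducible ψ) := ⟨hψirr⟩
  obtain ⟨A, B, hA, hB, hs⟩ : ∃ A B : (ZMod p)[X], A.degree < (k + 1 : ℕ) ∧ B.degree < (k + 1 : ℕ) ∧
      s = AdjoinRoot.mk ψ (A + Pz * B) := by
    obtain ⟨T, rfl⟩ := AdjoinRoot.mk_surjective s
    refine ⟨(T %ₘ ψ) %ₘ Pz, (T %ₘ ψ) /ₘ Pz, ?_, ?_, ?_⟩
    · rw [← hd, ← degree_eq_natDegree hPzmonic.ne_zero]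
      exact degree_modByMonic_lt _ hPzmonic
    · have h1 := natDegree_modByMonic_lt T hψm (by rintro h; simp [h] at hψd)
      have h2 := natDegree_divByMonic (T %ₘ ψ) hPzmonic
      refine degree_le_natDegree.trans_lt ?_
      exact_mod_cast (by omega)
    · rw [modByMonic_add_div]
      rw [← sub_eq_zero, ← map_sub, AdjoinRoot.mk_eq_zero]
      exact ⟨T /ₘ ψ, by linear_combination - modByMonic_add_div T ψ⟩
  obtain ⟨c, d, hcd, hco⟩ : ∃ c d : ZMod p, (c ≠ 0 ∨ d ≠ 0) ∧
      d * A.coeff k + (c - d * y₁) * B.coeff k = 0 := by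
    by_cases h : A.coeff k = 0 ∧ B.coeff k = 0
    · exact ⟨1, 0, by simp, by simp [h.2]⟩
    · refine ⟨y₁ * B.coeff k - A.coeff k, B.coeff k, ?_, by ring⟩
      by_contra! hc
      obtain ⟨h1, h2⟩ := hc
      simp [h2] at h1
      exact h ⟨h1, h2⟩
  set N := c ^ 2 - c * d * y₁ + d ^ 2 * y₀ with hN
  have hw : AdjoinRoot.mk ψ (Pz ^ 2 + C y₁ * Pz + C y₀) = 0 := by
    rw [← hψdef]; exact AdjoinRoot.mk_self
  have hcd' : c - d * y₁ ≠ 0 ∨ -d ≠ 0 := by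
    by_contra! hc
    obtain ⟨h1, h2⟩ := hc
    have h2 : d = 0 := by simpa using h2
    simp [h2] at h1
    simp [h1, h2] at hcd
  have hv := aux_ne p k Pz ψ hPzmonic hd hψd c d hcd
  have hvb := aux_ne p k Pz ψ hPzmonic hd hψd _ _ hcd'
  have hprod : AdjoinRoot.mk ψ (C c + C d * Pz) * AdjoinRoot.mk ψ (C (c - d * y₁) + C (-d) * Pz)
      = AdjoinRoot.mk ψ (C N) := by
    simp only [hN, map_add, map_mul, map_sub, map_neg, map_pow] at hw ⊢
    linear_combination (- (AdjoinRoot.mk ψ (C d)) ^ 2) * hw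
  have hN0 : N ≠ 0 := by
    intro h
    rw [h] at hprod
    simp only [map_zero] at hprod
    exact (mul_ne_zero hv hvb) hprod
  have hNi : AdjoinRoot.mk ψ (C N) * AdjoinRoot.mk ψ (C N⁻¹) = 1 := by
    rw [← map_mul, ← C_mul, mul_inv_cancel₀ hN0]; simp
  have hNi0 : AdjoinRoot.mk ψ (C N⁻¹) ≠ 0 := right_ne_zero_of_mul_eq_one hNi
  refine ⟨AdjoinRoot.mk ψ (C N⁻¹) * AdjoinRoot.mk ψ (C (c - d * y₁) + C (-d) * Pz),
    mul_ne_zero hNi0 hvb, ⟨N⁻¹ * (c - d * y₁), N⁻¹ * (-d), ?_⟩,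
    (C c * A - C (d * y₀) * B) + (C d * A + C (c - d * y₁) * B) * Pz, ?_, ?_⟩
  · rw [← map_mul]; congr 1; simp only [C_mul]; ring
  · have hlin : ∀ a b : ZMod p, (C a * A + C b * B).degree < (k + 1 : ℕ) := by
      intro a b
      rw [degree_lt_iff_coeff_zero] at hA hB ⊢
      intro i hi
      rw [coeff_add, coeff_C_mul, coeff_C_mul, hA i hi, hB i hi, mul_zero, mul_zero, add_zero]
    have hE : (C d * A + C (c - d * y₁) * B).degree < (k : ℕ) := by
      rw [degree_lt_iff_coeff_zero]
      intro i hi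
      rcases hi.eq_or_lt with rfl | hi
      · simpa only [coeff_add, coeff_C_mul] using hco
      · exact (degree_lt_iff_coeff_zero _ _).1 (hlin _ _) i hi
    rw [natDegree_le_iff_coeff_eq_zero]
    intro i hi
    rw [coeff_add]
    have e1 : (C c * A - C (d * y₀) * B).coeff i = 0 := by
      have := (degree_lt_iff_coeff_zero _ _).1 (hlin c (-(d * y₀))) i (by omega)
      simpa [sub_eq_add_neg] using this
    have e2 : ((C d * A + C (c - d * y₁) * B) * Pz).coeff i = 0 := by
      generalize C d * A + C (c - d * y₁) * B = E at hE
      by_cases h0 : E = 0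
      · simp [h0]
      apply coeff_eq_zero_of_natDegree_lt
      have := (natDegree_lt_iff_degree_lt h0).2 hE
      have := natDegree_mul_le (p := E) (q := Pz)
      omega
    rw [e1, e2, add_zero]
  · have hr : AdjoinRoot.mk ψ ((C c * A - C (d * y₀) * B) + (C d * A + C (c - d * y₁) * B) * Pz)
        = AdjoinRoot.mk ψ (C c + C d * Pz) * s := by
      rw [hs]
      simp only [map_add, map_mul, map_sub] at hw ⊢
      simp only [map_pow] at hw
      linear_combination (- (AdjoinRoot.mk ψ (C d)) * AdjoinRoot.mk ψ B) * hw
    rw [hr]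
    linear_combination (-s) * hNi - (AdjoinRoot.mk ψ (C N⁻¹) * s) * hprod
end

section
/- Let p be a prime and n an even integer with n ≥ 4. Let P_y = Y² + y₁Y + y₀ be a monic irreducible quadratic polynomial over 𝔽_p, let P_z ∈ 𝔽_p[X] be monic of degree n/2, and suppose ψ(X) = P_z(X)² + y₁·X·P_z(X) + y₀·X² is irreducible over 𝔽_p of degree n. Let K = 𝔽_p[X]/(ψ(X)) and let x denote the image of X in K (note x ≠ 0 since ψ is irreducible of degree ≥ 2). Then for every s ∈ K there exist u ∈ K with u ≠ 0 lying in the 𝔽_p-span of {1, P_z(x)·x⁻¹} (equivalently, u^(p²) = u), and a polynomial r ∈ 𝔽_p[X] with deg r ≤ n − 2, such that s = u · r(x). -/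
open Polynomial

/-- Degree reduction using a quadratic subfield, case
`ψ(X) = P_z(X)² + y₁·X·P_z(X) + y₀·X²`: every element `s` of `K = 𝔽_p[X]/(ψ)` is a
product `u · r(x)` where `u ≠ 0` lies in the `𝔽_p`-span of `{1, P_z(x)·x⁻¹}` (the
quadratic subfield) and `r` has degree at most `n - 2`. -/
theorem stmt4 (p : ℕ) [Fact p.Prime] (n : ℕ) (hn : 4 ≤ n) (hneven : Even n)
    (y₀ y₁ : ZMod p)
    (hPy : Irreducible (X ^ 2 + C y₁ * X + C y₀ : (ZMod p)[X]))
    (Pz : (ZMod p)[X]) (hPzmonic : Pz.Monic) (hPzdeg : Pz.natDegree = n / 2)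
    (ψ : (ZMod p)[X]) (hψdef : ψ = Pz ^ 2 + C y₁ * X * Pz + C y₀ * X ^ 2)
    (hψirr : Irreducible ψ) [Fact (Irreducible ψ)] (hψdeg : ψ.natDegree = n)
    (s : AdjoinRoot ψ) :
    ∃ u : AdjoinRoot ψ, u ≠ 0 ∧
      (∃ a b : ZMod p,
        u = AdjoinRoot.of ψ a +
              AdjoinRoot.of ψ b * AdjoinRoot.mk ψ Pz * (AdjoinRoot.root ψ)⁻¹) ∧
      ∃ r : (ZMod p)[X], r.natDegree ≤ n - 2 ∧ s = u * AdjoinRoot.mk ψ r := by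
  have hψ0 : ψ ≠ 0 := hψirr.ne_zero
  -- reduced representatives
  have hrep : ∀ t : AdjoinRoot ψ, ∃ g : (ZMod p)[X], g.natDegree ≤ n - 1 ∧
      t = AdjoinRoot.mk ψ g := by
    intro t
    obtain ⟨g, rfl⟩ := AdjoinRoot.mk_surjective t
    refine ⟨g % ψ, ?_, ?_⟩
    · have := Polynomial.natDegree_mod_lt g (q := ψ) (by omega)
      omega
    · rw [AdjoinRoot.mk_eq_mk]
      exact ⟨g / ψ, by rw [eq_comm, eq_sub_iff_add_eq]; exact EuclideanDomain.div_add_mod g ψ⟩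
  have hx : AdjoinRoot.root ψ ≠ 0 := by
    intro h
    rw [← AdjoinRoot.mk_X, AdjoinRoot.mk_eq_zero] at h
    have := Polynomial.natDegree_le_of_dvd h X_ne_zero
    rw [natDegree_X] at this
    omega
  have hroot : ∀ c : ZMod p, c ^ 2 + y₁ * c + y₀ ≠ 0 := by
    intro c hc
    have hd : (X ^ 2 + C y₁ * X + C y₀ : (ZMod p)[X]).natDegree = 2 := by
      compute_degree!
    have h1 := Polynomial.degree_eq_one_of_irreducible_of_root hPy (x := c) (by simpa using hc)
    rw [Polynomial.degree_eq_natDegree hPy.ne_zero, hd] at h1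
    norm_num at h1
  obtain ⟨y, hy⟩ : ∃ y, y = AdjoinRoot.mk ψ Pz * (AdjoinRoot.root ψ)⁻¹ := ⟨_, rfl⟩
  have hyx : AdjoinRoot.mk ψ Pz = y * AdjoinRoot.root ψ := by
    rw [hy]; field_simp
  have hyeq : y ^ 2 + AdjoinRoot.of ψ y₁ * y + AdjoinRoot.of ψ y₀ = 0 := by
    have h0 : AdjoinRoot.mk ψ (Pz ^ 2 + C y₁ * X * Pz + C y₀ * X ^ 2) = 0 := by
      rw [← hψdef]; exact AdjoinRoot.mk_self
    simp only [map_add, map_mul, map_pow, AdjoinRoot.mk_C, AdjoinRoot.mk_X, hyx] at h0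
    have : (y ^ 2 + AdjoinRoot.of ψ y₁ * y + AdjoinRoot.of ψ y₀) * AdjoinRoot.root ψ ^ 2 = 0 := by
      rw [← h0]; ring
    exact (mul_eq_zero.mp this).resolve_right (pow_ne_zero 2 hx)
  obtain ⟨S, hS, hsS⟩ := hrep s
  obtain ⟨T, hT, hsT⟩ := hrep (y * s)
  obtain ⟨a, b, hN, hc⟩ : ∃ a b : ZMod p, a ^ 2 - a * b * y₁ + b ^ 2 * y₀ ≠ 0 ∧
      a * S.coeff (n - 1) + b * T.coeff (n - 1) = 0 := by
    by_cases h : S.coeff (n - 1) = 0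
    · exact ⟨1, 0, by simp, by simp [h]⟩
    · refine ⟨-T.coeff (n - 1), S.coeff (n - 1), ?_, by ring⟩
      intro h2
      apply hroot (T.coeff (n - 1) / S.coeff (n - 1))
      field_simp
      linear_combination h2
  obtain ⟨N, hNdef⟩ : ∃ N, N = a ^ 2 - a * b * y₁ + b ^ 2 * y₀ := ⟨_, rfl⟩
  rw [← hNdef] at hN
  have hNN : AdjoinRoot.of ψ N⁻¹ * AdjoinRoot.of ψ N = 1 := by
    rw [← map_mul, inv_mul_cancel₀ hN, map_one]
  have hNe : AdjoinRoot.of ψ N = AdjoinRoot.of ψ a ^ 2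
      - AdjoinRoot.of ψ a * AdjoinRoot.of ψ b * AdjoinRoot.of ψ y₁
      + AdjoinRoot.of ψ b ^ 2 * AdjoinRoot.of ψ y₀ := by
    rw [hNdef]; simp only [map_add, map_sub, map_mul, map_pow]
  have huv : (AdjoinRoot.of ψ (N⁻¹ * (a - b * y₁)) + AdjoinRoot.of ψ (-(N⁻¹ * b)) * y) *
      (AdjoinRoot.of ψ a + AdjoinRoot.of ψ b * y) = 1 := by
    rw [← hNN, hNe]
    simp only [map_sub, map_mul, map_neg]
    linear_combination (-AdjoinRoot.of ψ N⁻¹ * AdjoinRoot.of ψ b ^ 2) * hyeq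
  refine ⟨_, left_ne_zero_of_mul_eq_one huv, ⟨_, _, by rw [mul_assoc, ← hy]⟩,
    C a * S + C b * T, ?_, ?_⟩
  · rw [Polynomial.natDegree_le_iff_coeff_eq_zero]
    intro m hm
    simp only [coeff_add, coeff_C_mul]
    rcases Nat.lt_or_ge (n - 1) m with h | h
    · rw [coeff_eq_zero_of_natDegree_lt (by omega), coeff_eq_zero_of_natDegree_lt (by omega)]
      simp
    · obtain rfl : m = n - 1 := by omega
      exact hc
  · simp only [map_add, map_mul (AdjoinRoot.mk ψ), AdjoinRoot.mk_C, ← hsS, ← hsT]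
    linear_combination (-s) * huv
end

section
/- Let p be a prime, ψ ∈ 𝔽_p[X] a monic irreducible polynomial of degree n, K = 𝔽_p[X]/(ψ(X)), and x the image of X in K. Let m be a positive divisor of n. Then for every s ∈ K there exist u ∈ K with u ≠ 0 and u^(p^m) = u (i.e., u lies in the subfield of K with p^m elements), and a polynomial r ∈ 𝔽_p[X] with deg r ≤ n − m, such that s = u · r(x). -/
open Polynomial

/-- General subfield degree reduction: if `m` is a positive divisor of `n` and
`K = 𝔽_p[X]/(ψ)` with `ψ` monic irreducible of degree `n`, then every `s ∈ K` is a
product `u · r(x)` with `u` a nonzero element of the subfield with `p^m` elements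
(i.e. `u^(p^m) = u`) and `r` of degree at most `n - m`. -/
theorem stmt5 (p : ℕ) [Fact p.Prime] (n : ℕ)
    (ψ : (ZMod p)[X]) (hψmonic : ψ.Monic) (hψirr : Irreducible ψ)
    (hψdeg : ψ.natDegree = n)
    (m : ℕ) (hm : 0 < m) (hmdvd : m ∣ n)
    (s : AdjoinRoot ψ) :
    ∃ u : AdjoinRoot ψ, u ≠ 0 ∧ u ^ (p ^ m) = u ∧
      ∃ r : (ZMod p)[X], r.natDegree ≤ n - m ∧ s = u * AdjoinRoot.mk ψ r := by
  haveI : Fact (Irreducible ψ) := ⟨hψirr⟩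
  have hn : 0 < n := hψdeg ▸ hψirr.natDegree_pos
  have hmn : m ≤ n := Nat.le_of_dvd hn hmdvd
  haveI : Module.Finite (ZMod p) (AdjoinRoot ψ) := hψmonic.finite_adjoinRoot
  haveI : Finite (AdjoinRoot ψ) := Module.finite_of_finite (ZMod p)
  have hfr : Module.finrank (ZMod p) (AdjoinRoot ψ) = n := by
    rw [(AdjoinRoot.powerBasis' hψmonic).finrank, AdjoinRoot.powerBasis'_dim, hψdeg]
  have hg : Module.finrank (ZMod p) (GaloisField p m) = m := GaloisField.finrank p hm.ne'
  obtain ⟨f⟩ := FiniteField.nonempty_algHom_of_finrank_dvd (F := ZMod p)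
    (K := GaloisField p m) (L := AdjoinRoot ψ) (by rw [hfr, hg]; exact hmdvd)
  let L : GaloisField p m →ₗ[ZMod p] (Fin (m - 1) → ZMod p) :=
    LinearMap.pi fun i => (Polynomial.lcoeff (ZMod p) (n - m + 1 + i)) ∘ₗ
      (AdjoinRoot.modByMonicHom hψmonic) ∘ₗ (LinearMap.mulRight (ZMod p) s) ∘ₗ f.toLinearMap
  have hker : LinearMap.ker L ≠ ⊥ := by
    apply LinearMap.ker_ne_bot_of_finrank_lt
    rw [hg, Module.finrank_fin_fun]
    omega
  obtain ⟨v, hv, hv0⟩ := Submodule.exists_mem_ne_zero_of_ne_bot hker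
  have hfv : f v ≠ 0 := (map_ne_zero f).2 hv0
  have hcard : Nat.card (GaloisField p m) = p ^ m := GaloisField.card p m hm.ne'
  have hpow : v ^ (p ^ m) = v := by
    haveI := Fintype.ofFinite (GaloisField p m)
    rw [← hcard, Nat.card_eq_fintype_card, FiniteField.pow_card]
  refine ⟨(f v)⁻¹, inv_ne_zero hfv, by rw [inv_pow, ← map_pow, hpow],
    AdjoinRoot.modByMonicHom hψmonic (f v * s), ?_, ?_⟩
  · rw [Polynomial.natDegree_le_iff_coeff_eq_zero]
    intro N hN
    by_cases h : N < n
    · have := congrFun (LinearMap.mem_ker.1 hv) ⟨N - (n - m + 1), by omega⟩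
      have e : n - m + 1 + (N - (n - m + 1)) = N := by omega
      simpa [L, e] using this
    · apply Polynomial.coeff_eq_zero_of_degree_lt
      obtain ⟨g, hgg⟩ := AdjoinRoot.mk_surjective (f v * s)
      rw [← hgg, AdjoinRoot.modByMonicHom_mk]
      refine (Polynomial.degree_modByMonic_lt g hψmonic).trans_le ?_
      rw [Polynomial.degree_eq_natDegree hψmonic.ne_zero, hψdeg]
      exact_mod_cast not_lt.1 h
  · rw [AdjoinRoot.mk_leftInverse hψmonic, inv_mul_cancel_left₀ hfv]
end
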